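/- Let H be an infinite-dimensional separable complex Hilbert space, let V be a finite-dimensional subspace of L¹(B(H)), and let x ∈ L¹(B(H)) \ V be a smooth point of L¹(B(H)) with respect to the trace norm. Write x = v|x| for the polar decomposition of x with unique associated partial isometry v. Then 0 is a best approximation to x out of V in the trace norm (i.e., dist₁(x,V) = ‖x‖₁) if and only if v* ∈ N_V, i.e., Tr(v* y) = 0 for all y ∈ V. -/

import Mathlib

open scoped InnerProductSpace

/-- The absolute value `|a| = sqrt (a* a)` of a bounded operator, via the
continuous functional calculus. -/
noncomputable def opAbs {H : Type*} [NormedAddCommGroup H] [InnerProductSpace ℂ H]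
    [CompleteSpace H] (a : H →L[ℂ] H) : H →L[ℂ] H :=
  CFC.sqrt (ContinuousLinearMap.adjoint a * a)

/-- The trace of an operator computed along a fixed Hilbert basis (for trace class
operators this is basis-independent and is the usual trace). -/
noncomputable def traceAlong {H : Type*} [NormedAddCommGroup H] [InnerProductSpace ℂ H]
    [CompleteSpace H] (b : HilbertBasis ℕ ℂ H) (a : H →L[ℂ] H) : ℂ :=
  ∑' n, ⟪b n, a (b n)⟫_ℂ

/-- `a` is trace class: `∑ ⟨eₙ, |a| eₙ⟩ < ∞` (basis-independent for the positive
operator `|a|`). -/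
def IsTraceClass {H : Type*} [NormedAddCommGroup H] [InnerProductSpace ℂ H]
    [CompleteSpace H] (b : HilbertBasis ℕ ℂ H) (a : H →L[ℂ] H) : Prop :=
  Summable fun n => (⟪b n, opAbs a (b n)⟫_ℂ).re

/-- The trace norm `‖a‖₁ = Tr |a|`. -/
noncomputable def traceNorm {H : Type*} [NormedAddCommGroup H] [InnerProductSpace ℂ H]
    [CompleteSpace H] (b : HilbertBasis ℕ ℂ H) (a : H →L[ℂ] H) : ℝ :=
  ∑' n, (⟪b n, opAbs a (b n)⟫_ℂ).re

open ContinuousLinearMap Filter Topology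

section TraceClass

variable {H : Type*} [NormedAddCommGroup H] [InnerProductSpace ℂ H] [CompleteSpace H]
  {b : HilbertBasis ℕ ℂ H}

/-- The Hilbert–Schmidt norm of `T`, computed along `b`, is at most `C`. -/
def HilbertSchmidtLE (b : HilbertBasis ℕ ℂ H) (T : H →L[ℂ] H) (C : ℝ) : Prop :=
  ∀ F : Finset ℕ, ∑ n ∈ F, ‖T (b n)‖ ^ 2 ≤ C ^ 2

namespace HilbertSchmidtLE

variable {S T : H →L[ℂ] H} {C D : ℝ}

theorem adjoint (hT : HilbertSchmidtLE b T C) :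
    HilbertSchmidtLE b (ContinuousLinearMap.adjoint T) C := by
  intro F
  have hparseval (ξ : H) : HasSum (fun n => ‖⟪b n, ξ⟫_ℂ‖ ^ 2) (‖ξ‖ ^ 2) := by
    have h := b.hasSum_inner_mul_inner ξ ξ
    have h2 := (Complex.hasSum_iff _ _).1 h |>.1
    convert h2 using 1
    · ext n
      rw [← inner_conj_symm ξ (b n), Complex.conj_mul']
      norm_cast
    · rw [inner_self_eq_norm_sq_to_K]
      norm_cast
  have hsum := hasSum_sum (s := F) fun m _ => hparseval (ContinuousLinearMap.adjoint T (b m))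
  refine hasSum_le_of_sum_le hsum fun G => ?_
  refine (Finset.sum_le_sum fun n _ => ?_).trans (hT G)
  have h := b.orthonormal.sum_inner_products_le (T (b n)) (s := F)
  refine le_trans (le_of_eq (Finset.sum_congr rfl fun m _ => ?_)) h
  rw [ContinuousLinearMap.adjoint_inner_right, norm_inner_symm]

omit [CompleteSpace H] in
theorem mul_left (a : H →L[ℂ] H) (hT : HilbertSchmidtLE b T C) :
    HilbertSchmidtLE b (a * T) (‖a‖ * C) := by
  intro F
  calc ∑ n ∈ F, ‖(a * T) (b n)‖ ^ 2 ≤ ∑ n ∈ F, ‖a‖ ^ 2 * ‖T (b n)‖ ^ 2 := by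
        refine Finset.sum_le_sum fun n _ => ?_
        rw [← mul_pow]
        gcongr
        exact a.le_opNorm _
    _ ≤ (‖a‖ * C) ^ 2 := by
        rw [← Finset.mul_sum, mul_pow]
        gcongr
        exact hT F

theorem sum_norm_inner_le (hT : HilbertSchmidtLE b T C) (hS : HilbertSchmidtLE b S D)
    (hC : 0 ≤ C) (hD : 0 ≤ D) (F : Finset ℕ) :
    ∑ n ∈ F, ‖⟪b n, (T * S) (b n)⟫_ℂ‖ ≤ C * D := by
  calc ∑ n ∈ F, ‖⟪b n, (T * S) (b n)⟫_ℂ‖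
      ≤ ∑ n ∈ F, ‖ContinuousLinearMap.adjoint T (b n)‖ * ‖S (b n)‖ := by
        refine Finset.sum_le_sum fun n _ => ?_
        rw [mul_apply_eq_comp, ← ContinuousLinearMap.adjoint_inner_left]
        exact norm_inner_le_norm _ _
    _ ≤ C * D := by
        refine abs_le_of_sq_le_sq' ?_ (by positivity) |>.2
        refine (Finset.sum_mul_sq_le_sq_mul_sq F _ _).trans ?_
        rw [mul_pow]
        gcongr
        · exact hT.adjoint F
        · exact hS F

theorem summable_inner (hT : HilbertSchmidtLE b T C) (hS : HilbertSchmidtLE b S D)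
    (hC : 0 ≤ C) (hD : 0 ≤ D) : Summable fun n => ⟪b n, (T * S) (b n)⟫_ℂ :=
  .of_norm <| summable_of_sum_le (fun _ => norm_nonneg _) (hT.sum_norm_inner_le hS hC hD)

theorem norm_traceAlong_le (hT : HilbertSchmidtLE b T C) (hS : HilbertSchmidtLE b S D)
    (hC : 0 ≤ C) (hD : 0 ≤ D) : ‖traceAlong b (T * S)‖ ≤ C * D := by
  have h := summable_of_sum_le (fun _ => norm_nonneg _) (hT.sum_norm_inner_le hS hC hD)
  exact (norm_tsum_le_tsum_norm h).trans
    (h.tsum_le_of_sum_le (hT.sum_norm_inner_le hS hC hD))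

end HilbertSchmidtLE

theorem opAbs_mul_self (a : H →L[ℂ] H) :
    opAbs a * opAbs a = ContinuousLinearMap.adjoint a * a :=
  CFC.abs_mul_abs a

theorem opAbs_nonneg (a : H →L[ℂ] H) : 0 ≤ opAbs a :=
  CFC.abs_nonneg a

theorem adjoint_opAbs (a : H →L[ℂ] H) : ContinuousLinearMap.adjoint (opAbs a) = opAbs a :=
  (IsSelfAdjoint.of_nonneg (opAbs_nonneg a)).star_eq

theorem norm_opAbs_apply (a : H →L[ℂ] H) (ξ : H) : ‖opAbs a ξ‖ = ‖a ξ‖ := by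
  have h : ⟪opAbs a ξ, opAbs a ξ⟫_ℂ = ⟪a ξ, a ξ⟫_ℂ := by
    rw [← ContinuousLinearMap.adjoint_inner_right, ← ContinuousLinearMap.adjoint_inner_right,
      adjoint_opAbs, ← mul_apply_eq_comp, opAbs_mul_self,
      mul_apply_eq_comp]
  rw [inner_self_eq_norm_sq_to_K, inner_self_eq_norm_sq_to_K] at h
  exact (pow_left_inj₀ (norm_nonneg _) (norm_nonneg _) two_ne_zero).1 (by exact_mod_cast h)

theorem adjoint_apply_apply_of_norm_eq {u : H →L[ℂ] H} (hu : ‖u‖ ≤ 1) {ξ : H}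
    (hξ : ‖u ξ‖ = ‖ξ‖) : ContinuousLinearMap.adjoint u (u ξ) = ξ := by
  have h1 : ‖ContinuousLinearMap.adjoint u (u ξ)‖ ≤ ‖ξ‖ := by
    rw [← hξ]
    have hu' : ‖ContinuousLinearMap.adjoint u‖ ≤ 1 := by rwa [LinearIsometryEquiv.norm_map]
    exact (ContinuousLinearMap.le_of_opNorm_le _ hu' _).trans_eq (one_mul _)
  have h2 := norm_sub_sq (𝕜 := ℂ) (ContinuousLinearMap.adjoint u (u ξ)) ξ
  rw [ContinuousLinearMap.adjoint_inner_left, ← norm_sq_eq_re_inner, hξ] at h2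
  have h3 : ‖ContinuousLinearMap.adjoint u (u ξ)‖ ^ 2 ≤ ‖ξ‖ ^ 2 := by gcongr
  rw [← sub_eq_zero, ← norm_eq_zero]
  exact pow_eq_zero_iff two_ne_zero |>.1 (le_antisymm (by linarith) (by positivity))

/-- Polar decomposition, with a contraction in place of a partial isometry. -/
theorem exists_contraction_mul_opAbs (y : H →L[ℂ] H) : ∃ u : H →L[ℂ] H,
    ‖u‖ ≤ 1 ∧ u * opAbs y = y ∧ ContinuousLinearMap.adjoint u * y = opAbs y := by
  let K : Submodule ℂ H := (LinearMap.range (opAbs y).toLinearMap).topologicalClosure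
  have hmem (ξ : H) : opAbs y ξ ∈ K :=
    Submodule.le_topologicalClosure _ (LinearMap.mem_range_self (opAbs y).toLinearMap ξ)
  have : CompleteSpace K :=
    (Submodule.isClosed_topologicalClosure _).completeSpace_coe
  let e : H →ₗ[ℂ] K := (opAbs y).toLinearMap.codRestrict K hmem
  have hdense : DenseRange e := by
    intro z
    have hz : (z : H) ∈ closure (Set.range (opAbs y)) := z.2
    rw [Topology.IsInducing.subtypeVal.closure_eq_preimage_closure_image, Set.mem_preimage,
      ← Set.range_comp]
    exact hz
  have hnorm (ξ : H) : ‖y.toLinearMap ξ‖ ≤ 1 * ‖e ξ‖ := by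
    rw [one_mul]
    exact (norm_opAbs_apply y ξ).ge
  let w : K →L[ℂ] H := y.toLinearMap.extendOfNorm e
  have hw (ξ : H) : w (e ξ) = y ξ := LinearMap.extendOfNorm_eq hdense ⟨1, hnorm⟩ ξ
  have hw1 : ‖w‖ ≤ 1 := LinearMap.opNorm_extendOfNorm_le hdense zero_le_one hnorm
  let u : H →L[ℂ] H := w ∘L K.orthogonalProjectionOnto
  have hu : ‖u‖ ≤ 1 := by
    refine (ContinuousLinearMap.opNorm_comp_le _ _).trans ?_
    exact mul_le_one₀ hw1 (norm_nonneg _) K.orthogonalProjectionOnto_norm_le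
  have huy (ξ : H) : u (opAbs y ξ) = y ξ := by
    rw [← hw ξ]
    exact congrArg w (K.orthogonalProjectionOnto_mem_subspace_eq_self (e ξ))
  refine ⟨u, hu, ContinuousLinearMap.ext huy, ContinuousLinearMap.ext fun ξ => ?_⟩
  rw [mul_apply_eq_comp, ← huy ξ]
  exact adjoint_apply_apply_of_norm_eq hu (by rw [huy, norm_opAbs_apply])

theorem re_inner_opAbs_nonneg (y : H →L[ℂ] H) (ξ : H) : 0 ≤ (⟪ξ, opAbs y ξ⟫_ℂ).re :=
  ((ContinuousLinearMap.nonneg_iff_isPositive _).1 (opAbs_nonneg y)).re_inner_nonneg_right ξ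

theorem traceNorm_nonneg (b : HilbertBasis ℕ ℂ H) (y : H →L[ℂ] H) : 0 ≤ traceNorm b y :=
  tsum_nonneg fun _ => re_inner_opAbs_nonneg y _

theorem norm_sqrt_opAbs_sq (y : H →L[ℂ] H) (ξ : H) :
    ‖CFC.sqrt (opAbs y) ξ‖ ^ 2 = (⟪ξ, opAbs y ξ⟫_ℂ).re := by
  have hs : ContinuousLinearMap.adjoint (CFC.sqrt (opAbs y)) = CFC.sqrt (opAbs y) :=
    (IsSelfAdjoint.of_nonneg (CFC.sqrt_nonneg (opAbs y))).star_eq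
  conv_rhs => rw [← CFC.sqrt_mul_sqrt_self (opAbs y) (opAbs_nonneg y)]
  rw [mul_apply_eq_comp, ← ContinuousLinearMap.adjoint_inner_left, hs]
  exact norm_sq_eq_re_inner (𝕜 := ℂ) _

theorem HilbertSchmidtLE.isTraceClass_mul {S T : H →L[ℂ] H} {C D : ℝ}
    (hT : HilbertSchmidtLE b T C) (hS : HilbertSchmidtLE b S D) (hC : 0 ≤ C) (hD : 0 ≤ D) :
    IsTraceClass b (T * S) ∧ traceNorm b (T * S) ≤ C * D := by
  obtain ⟨u, hu, -, h⟩ := exists_contraction_mul_opAbs (T * S)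
  have hu' : ‖ContinuousLinearMap.adjoint u‖ ≤ 1 := by rwa [LinearIsometryEquiv.norm_map]
  have hbound (F : Finset ℕ) : ∑ n ∈ F, (⟪b n, opAbs (T * S) (b n)⟫_ℂ).re ≤ C * D := by
    have h1 := (hT.mul_left (ContinuousLinearMap.adjoint u)).sum_norm_inner_le hS
      (by positivity) hD F
    rw [mul_assoc, h] at h1
    calc _ ≤ ∑ n ∈ F, ‖⟪b n, opAbs (T * S) (b n)⟫_ℂ‖ :=
          Finset.sum_le_sum fun n _ => Complex.re_le_norm _
      _ ≤ _ := h1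
      _ ≤ 1 * C * D := by gcongr
      _ = C * D := by ring
  have hsum : IsTraceClass b (T * S) :=
    summable_of_sum_le (fun n => re_inner_opAbs_nonneg _ _) hbound
  exact ⟨hsum, hsum.tsum_le_of_sum_le hbound⟩

theorem IsTraceClass.hilbertSchmidtLE_sqrt {y : H →L[ℂ] H} (hy : IsTraceClass b y) :
    HilbertSchmidtLE b (CFC.sqrt (opAbs y)) √(traceNorm b y) := by
  intro F
  simp_rw [norm_sqrt_opAbs_sq, Real.sq_sqrt (traceNorm_nonneg b y)]
  exact hy.sum_le_tsum F fun n _ => re_inner_opAbs_nonneg y _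

theorem IsTraceClass.exists_factorization {y : H →L[ℂ] H} (hy : IsTraceClass b y) :
    ∃ S T : H →L[ℂ] H, y = T * S ∧ HilbertSchmidtLE b T √(traceNorm b y) ∧
      HilbertSchmidtLE b S √(traceNorm b y) := by
  obtain ⟨u, hu, h, -⟩ := exists_contraction_mul_opAbs y
  refine ⟨CFC.sqrt (opAbs y), u * CFC.sqrt (opAbs y), ?_, fun F => ?_,
    hy.hilbertSchmidtLE_sqrt⟩
  · rw [mul_assoc, CFC.sqrt_mul_sqrt_self (opAbs y) (opAbs_nonneg y), h]
  · refine (hy.hilbertSchmidtLE_sqrt.mul_left u F).trans ?_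
    gcongr
    exact mul_le_of_le_one_left (Real.sqrt_nonneg _) hu

theorem IsTraceClass.summable_mul (a : H →L[ℂ] H) {y : H →L[ℂ] H} (hy : IsTraceClass b y) :
    Summable fun n => ⟪b n, (a * y) (b n)⟫_ℂ := by
  obtain ⟨S, T, h, hT, hS⟩ := hy.exists_factorization
  have := (hT.mul_left a).summable_inner hS (by positivity) (by positivity)
  rwa [mul_assoc, ← h] at this

theorem IsTraceClass.norm_traceAlong_mul_le (a : H →L[ℂ] H) {y : H →L[ℂ] H}
    (hy : IsTraceClass b y) : ‖traceAlong b (a * y)‖ ≤ ‖a‖ * traceNorm b y := by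
  obtain ⟨S, T, h, hT, hS⟩ := hy.exists_factorization
  have := (hT.mul_left a).norm_traceAlong_le hS (by positivity) (by positivity)
  rwa [mul_assoc, ← h, mul_assoc, Real.mul_self_sqrt (traceNorm_nonneg b y)] at this

theorem IsTraceClass.smul (c : ℂ) {y : H →L[ℂ] H} (hy : IsTraceClass b y) :
    IsTraceClass b (c • y) ∧ traceNorm b (c • y) ≤ ‖c‖ * traceNorm b y := by
  obtain ⟨S, T, h, hT, hS⟩ := hy.exists_factorization
  have hT' : HilbertSchmidtLE b (c • T) (‖c‖ * √(traceNorm b y)) := by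
    intro F
    simp_rw [smul_apply, norm_smul, mul_pow, ← Finset.mul_sum]
    gcongr
    exact hT F
  have := hT'.isTraceClass_mul hS (by positivity) (by positivity)
  rwa [smul_mul_assoc, ← h, mul_assoc, Real.mul_self_sqrt (traceNorm_nonneg b y)] at this

theorem traceAlong_mul_add (a : H →L[ℂ] H) {y z : H →L[ℂ] H} (hy : IsTraceClass b y)
    (hz : IsTraceClass b z) :
    traceAlong b (a * (y + z)) = traceAlong b (a * y) + traceAlong b (a * z) := by
  rw [traceAlong, traceAlong, traceAlong,
    ← (hy.summable_mul a).tsum_add (hz.summable_mul a)]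
  simp [mul_add]

theorem traceAlong_opAbs (b : HilbertBasis ℕ ℂ H) (y : H →L[ℂ] H) :
    traceAlong b (opAbs y) = (traceNorm b y : ℂ) := by
  rw [traceAlong, traceNorm, Complex.ofReal_tsum]
  refine tsum_congr fun n => ?_
  exact (((ContinuousLinearMap.nonneg_iff_isPositive _).1
    (opAbs_nonneg y)).isSymmetric.coe_re_inner_self_apply (b n)).symm

theorem IsTraceClass.add {y z : H →L[ℂ] H} (hy : IsTraceClass b y) (hz : IsTraceClass b z) :
    IsTraceClass b (y + z) ∧ traceNorm b (y + z) ≤ traceNorm b y + traceNorm b z := by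
  obtain ⟨u, hu, -, h⟩ := exists_contraction_mul_opAbs (y + z)
  have hu' : ‖ContinuousLinearMap.adjoint u‖ ≤ 1 := by rwa [LinearIsometryEquiv.norm_map]
  have hsum : IsTraceClass b (y + z) := by
    have := (hy.summable_mul (ContinuousLinearMap.adjoint u)).add
      (hz.summable_mul (ContinuousLinearMap.adjoint u))
    have h2 := (Complex.hasSum_re this.hasSum).summable
    refine h2.congr fun n => ?_
    rw [← inner_add_right, ← add_apply, ← mul_add, h]
  refine ⟨hsum, ?_⟩
  have h3 := traceAlong_opAbs b (y + z)
  rw [← h, traceAlong_mul_add _ hy hz] at h3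
  have h4 : traceNorm b (y + z) ≤ ‖(traceNorm b (y + z) : ℂ)‖ := by
    rw [Complex.norm_real]; exact le_abs_self _
  rw [← h3] at h4
  refine h4.trans ((norm_add_le _ _).trans (add_le_add ?_ ?_))
  · exact (hy.norm_traceAlong_mul_le _).trans
      (mul_le_of_le_one_left (traceNorm_nonneg b y) hu')
  · exact (hz.norm_traceAlong_mul_le _).trans
      (mul_le_of_le_one_left (traceNorm_nonneg b z) hu')

variable (b) in
/-- The trace class operators, as a subspace of the bounded operators. -/
def traceClass : Submodule ℂ (H →L[ℂ] H) where
  carrier := {y | IsTraceClass b y}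
  add_mem' hy hz := (IsTraceClass.add hy hz).1
  zero_mem' := by simp [IsTraceClass, opAbs]
  smul_mem' c _ hy := (IsTraceClass.smul c hy).1

variable (b) in
/-- The trace norm, as a seminorm on the trace class operators. -/
noncomputable def traceSeminorm : Seminorm ℂ (traceClass b) :=
  .ofSMulLE (fun y => traceNorm b (y : H →L[ℂ] H)) (by simp [traceNorm, opAbs])
    (fun y z => (IsTraceClass.add y.2 z.2).2) fun c y => (IsTraceClass.smul c y.2).2

theorem isTraceClass_sub {y z : H →L[ℂ] H} (hy : IsTraceClass b y) (hz : IsTraceClass b z) :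
    IsTraceClass b (y - z) :=
  (traceClass b).sub_mem hy hz

theorem traceNorm_pos {y : H →L[ℂ] H} (hy : IsTraceClass b y) (h0 : y ≠ 0) :
    0 < traceNorm b y := by
  refine (traceNorm_nonneg b y).lt_of_ne fun h => h0 ?_
  have hbasis (n : ℕ) : CFC.sqrt (opAbs y) (b n) = 0 := by
    have := hy.hilbertSchmidtLE_sqrt {n}
    simp_rw [Finset.sum_singleton, ← h, Real.sqrt_zero] at this
    simpa using this
  have hs : CFC.sqrt (opAbs y) = 0 := by
    refine ContinuousLinearMap.ext_on (s := Set.range b) ?_ ?_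
    · have := congrArg (fun K : Submodule ℂ H => (K : Set H)) b.dense_span
      exact dense_iff_closure_eq.2 this
    · rintro _ ⟨n, rfl⟩
      simpa using hbasis n
  obtain ⟨u, -, hu, -⟩ := exists_contraction_mul_opAbs y
  rw [← hu, ← CFC.sqrt_mul_sqrt_self (opAbs y) (opAbs_nonneg y), hs]
  simp

theorem isTraceClass_rankOne (b : HilbertBasis ℕ ℂ H) (η ξ : H) :
    IsTraceClass b (InnerProductSpace.rankOne ℂ η ξ) ∧
      traceNorm b (InnerProductSpace.rankOne ℂ η ξ) ≤ ‖η‖ * ‖ξ‖ := by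
  have hHS (ζ χ : H) :
      HilbertSchmidtLE b (InnerProductSpace.rankOne ℂ ζ χ) (‖ζ‖ * ‖χ‖) := by
    intro F
    simp_rw [InnerProductSpace.rankOne_apply, norm_smul, mul_pow, ← Finset.sum_mul]
    rw [mul_comm]
    gcongr
    simp_rw [norm_inner_symm χ]
    exact b.orthonormal.sum_inner_products_le χ
  have hb : ‖b 0‖ = 1 := b.orthonormal.norm_eq_one 0
  have h := (hHS η (b 0)).isTraceClass_mul (hHS (b 0) ξ) (by positivity) (by positivity)
  have hmul : InnerProductSpace.rankOne ℂ η (b 0) * InnerProductSpace.rankOne ℂ (b 0) ξ =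
      InnerProductSpace.rankOne ℂ η ξ := by
    rw [ContinuousLinearMap.mul_def, InnerProductSpace.rankOne_comp_rankOne,
      inner_self_eq_norm_sq_to_K, hb]
    simp
  rwa [hmul, hb, mul_one, one_mul] at h

/-- Finite rank truncations along the basis converge in trace norm. -/
theorem tendsto_traceNorm_sub_sum_rankOne {y : H →L[ℂ] H} (hy : IsTraceClass b y) :
    Tendsto (fun n => traceNorm b
      (y - ∑ k ∈ Finset.range n, InnerProductSpace.rankOne ℂ (y (b k)) (b k))) atTop (𝓝 0) := by
  obtain ⟨S, T, h, hT, hS⟩ := hy.exists_factorization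
  have hsum : Summable fun k => ‖S (b k)‖ ^ 2 :=
    summable_of_sum_le (fun _ => by positivity) hS
  let R (n : ℕ) : H →L[ℂ] H :=
    S - ∑ k ∈ Finset.range n, InnerProductSpace.rankOne ℂ (S (b k)) (b k)
  let D (n : ℕ) : ℝ := √(∑' k, ‖S (b k)‖ ^ 2 - ∑ k ∈ Finset.range n, ‖S (b k)‖ ^ 2)
  have hR (n j : ℕ) : R n (b j) = if j ∈ Finset.range n then 0 else S (b j) := by
    simp only [R, sub_apply, sum_apply, InnerProductSpace.rankOne_apply,
      orthonormal_iff_ite.1 b.orthonormal, ite_smul, one_smul, zero_smul, Finset.sum_ite_eq']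
    split_ifs <;> simp
  have hHS (n : ℕ) : HilbertSchmidtLE b (R n) (D n) := by
    intro F
    rw [Real.sq_sqrt (sub_nonneg.2 (hsum.sum_le_tsum _ fun _ _ => by positivity)),
      le_sub_iff_add_le]
    calc _ = ∑ j ∈ F \ Finset.range n, ‖S (b j)‖ ^ 2 +
          ∑ k ∈ Finset.range n, ‖S (b k)‖ ^ 2 := by
          congr 1
          rw [Finset.sdiff_eq_filter, Finset.sum_filter]
          refine Finset.sum_congr rfl fun j _ => ?_
          rw [hR]
          split_ifs <;> simp_all
      _ = ∑ j ∈ (F \ Finset.range n) ∪ Finset.range n, ‖S (b j)‖ ^ 2 :=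
          (Finset.sum_union Finset.sdiff_disjoint).symm
      _ ≤ _ := hsum.sum_le_tsum _ fun _ _ => by positivity
  have hmul (n : ℕ) : T * R n =
      y - ∑ k ∈ Finset.range n, InnerProductSpace.rankOne ℂ (y (b k)) (b k) := by
    simp only [R, mul_sub, Finset.mul_sum, ContinuousLinearMap.mul_def,
      InnerProductSpace.comp_rankOne, h, ContinuousLinearMap.comp_apply]
  have hD : Tendsto D atTop (𝓝 0) := by
    have := (hsum.hasSum.tendsto_sum_nat.const_sub (∑' k, ‖S (b k)‖ ^ 2)).sqrt
    simpa using this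
  refine squeeze_zero (fun _ => traceNorm_nonneg b _) (fun n => ?_)
    (by simpa using hD.const_mul √(traceNorm b y))
  rw [← hmul]
  exact (hT.isTraceClass_mul (hHS n) (Real.sqrt_nonneg _) (Real.sqrt_nonneg _)).2

/-- Trace duality: functionals dominated by the trace norm are given by operators in the unit
ball. -/
theorem exists_traceAlong_mul_eq (f : (H →L[ℂ] H) →ₗ[ℂ] ℂ)
    (hf : ∀ y, IsTraceClass b y → ‖f y‖ ≤ traceNorm b y) :
    ∃ a : H →L[ℂ] H, ‖a‖ ≤ 1 ∧ ∀ y, IsTraceClass b y → traceAlong b (a * y) = f y := by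
  let B₀ : H →ₗ⋆[ℂ] H →ₗ[ℂ] ℂ := LinearMap.mk₂'ₛₗ (starRingEnd ℂ) (RingHom.id ℂ)
    (fun ξ η => f (InnerProductSpace.rankOne ℂ η ξ)) (by simp) (by simp) (by simp) (by simp)
  have hB₀ (ξ η : H) : ‖B₀ ξ η‖ ≤ 1 * ‖ξ‖ * ‖η‖ := by
    rw [one_mul, mul_comm]
    exact (hf _ (isTraceClass_rankOne b η ξ).1).trans (isTraceClass_rankOne b η ξ).2
  let B := B₀.mkContinuous₂ 1 hB₀
  have hB : ‖B‖ ≤ 1 := LinearMap.mkContinuous₂_norm_le _ zero_le_one _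
  let c := InnerProductSpace.continuousLinearMapOfBilin B
  have hc : ‖c‖ ≤ 1 := by
    refine ContinuousLinearMap.opNorm_le_bound _ zero_le_one fun ξ => ?_
    have : ‖c ξ‖ = ‖B ξ‖ := (InnerProductSpace.toDual ℂ H).symm.norm_map (B ξ)
    rw [this]
    exact B.le_of_opNorm_le hB ξ
  have hinner (ξ η : H) : ⟪ξ, ContinuousLinearMap.adjoint c η⟫_ℂ =
      f (InnerProductSpace.rankOne ℂ η ξ) := by
    rw [ContinuousLinearMap.adjoint_inner_right]
    exact InnerProductSpace.continuousLinearMapOfBilin_apply B ξ η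
  refine ⟨ContinuousLinearMap.adjoint c, by rwa [LinearIsometryEquiv.norm_map], fun y hy => ?_⟩
  have h1 := (hy.summable_mul (ContinuousLinearMap.adjoint c)).hasSum.tendsto_sum_nat
  refine tendsto_nhds_unique h1 ?_
  rw [tendsto_iff_norm_sub_tendsto_zero]
  refine squeeze_zero (fun _ => norm_nonneg _) (fun n => ?_)
    (tendsto_traceNorm_sub_sum_rankOne hy)
  rw [norm_sub_rev]
  simp_rw [mul_apply_eq_comp, hinner, ← map_sum, ← map_sub]
  exact hf _ (isTraceClass_sub hy
    ((traceClass b).sum_mem fun k _ => (isTraceClass_rankOne b _ _).1))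

/-- Hahn–Banach separation of `x` from `V` when `0` is a best approximation to `x`. -/
theorem exists_functional_of_traceNorm_le {V : Submodule ℂ (H →L[ℂ] H)}
    (hV : ∀ w ∈ V, IsTraceClass b w) {x : H →L[ℂ] H} (hxt : IsTraceClass b x) (hx : x ∉ V)
    (hbest : ∀ w ∈ V, traceNorm b x ≤ traceNorm b (x - w)) :
    ∃ f : (H →L[ℂ] H) →ₗ[ℂ] ℂ, (∀ y, IsTraceClass b y → ‖f y‖ ≤ traceNorm b y) ∧
      f x = (traceNorm b x : ℂ) ∧ ∀ w ∈ V, f w = 0 := by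
  obtain ⟨φ, hφV, hφx⟩ :=
    LinearMap.exists_extend_of_notMem (0 : V →ₗ[ℂ] ℂ) hx (traceNorm b x : ℂ)
  have hφ0 (w : H →L[ℂ] H) (hw : w ∈ V) : φ w = 0 := by
    simpa using congr($hφV ⟨w, hw⟩)
  let W : Submodule ℂ (traceClass b) := (V ⊔ ℂ ∙ x).comap (traceClass b).subtype
  have hbound (s : W) : ‖(φ ∘ₗ (traceClass b).subtype ∘ₗ W.subtype) s‖ ≤
      traceSeminorm b (s : traceClass b) := by
    obtain ⟨⟨y, hy⟩, hyW⟩ := s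
    change ‖φ y‖ ≤ traceNorm b y
    obtain ⟨w, hw, z, hz, rfl⟩ := Submodule.mem_sup.1 (show y ∈ V ⊔ ℂ ∙ x from hyW)
    obtain ⟨c, rfl⟩ := Submodule.mem_span_singleton.1 hz
    rw [map_add, hφ0 w hw, zero_add, map_smul, hφx, norm_smul, Complex.norm_real,
      Real.norm_of_nonneg (traceNorm_nonneg b x)]
    rcases eq_or_ne c 0 with rfl | hc
    · simpa using traceNorm_nonneg b w
    have h1 := hbest _ (V.smul_mem (-c⁻¹) hw)
    have h2 := (IsTraceClass.smul c⁻¹ hy).2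
    have h3 : c⁻¹ • (w + c • x) = x - -c⁻¹ • w := by
      rw [smul_add, smul_smul, inv_mul_cancel₀ hc, one_smul, neg_smul, sub_neg_eq_add, add_comm]
    rw [h3, norm_inv] at h2
    calc ‖c‖ * traceNorm b x ≤ ‖c‖ * (‖c‖⁻¹ * traceNorm b (w + c • x)) := by
          gcongr
          exact h1.trans h2
      _ = traceNorm b (w + c • x) := mul_inv_cancel_left₀ (norm_ne_zero_iff.2 hc) _
  obtain ⟨g, hg, hgle⟩ := Module.Dual.exists_extension_of_le_seminorm W _ hbound
  obtain ⟨f, hf⟩ := LinearMap.exists_extend g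
  have hfg (y : H →L[ℂ] H) (hy : IsTraceClass b y) : f y = g ⟨y, hy⟩ := congr($hf ⟨y, hy⟩)
  have hfW (y : H →L[ℂ] H) (hy : IsTraceClass b y) (hyW : y ∈ V ⊔ ℂ ∙ x) : f y = φ y :=
    (hfg y hy).trans (hg ⟨⟨y, hy⟩, hyW⟩)
  refine ⟨f, fun y hy => ?_, ?_, fun w hw => ?_⟩
  · rw [hfg y hy]
    exact hgle ⟨y, hy⟩
  · rw [hfW x hxt (Submodule.mem_sup_right (Submodule.mem_span_singleton_self x)), hφx]
  · rw [hfW w (hV w hw) (Submodule.mem_sup_left hw), hφ0 w hw]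

theorem norm_eq_one_of_traceAlong_mul_eq {a y : H →L[ℂ] H} (hy : IsTraceClass b y) (h0 : y ≠ 0)
    (ha : ‖a‖ ≤ 1) (h : traceAlong b (a * y) = (traceNorm b y : ℂ)) : ‖a‖ = 1 := by
  refine le_antisymm ha ?_
  have h1 := hy.norm_traceAlong_mul_le a
  rw [h, Complex.norm_real, Real.norm_of_nonneg (traceNorm_nonneg b y)] at h1
  exact le_of_mul_le_mul_right (by rwa [one_mul]) (traceNorm_pos hy h0)

theorem norm_le_one_of_mul_adjoint_mul_self {v : H →L[ℂ] H}
    (h : v * ContinuousLinearMap.adjoint v * v = v) : ‖v‖ ≤ 1 := by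
  have h1 : ‖ContinuousLinearMap.adjoint v * v‖ = ‖v‖ * ‖v‖ := CStarRing.norm_star_mul_self
  have hidem : ContinuousLinearMap.adjoint v * v * (ContinuousLinearMap.adjoint v * v) =
      ContinuousLinearMap.adjoint v * v := by
    rw [mul_assoc, ← mul_assoc v, h]
  have h2 : ‖ContinuousLinearMap.adjoint v * v * (ContinuousLinearMap.adjoint v * v)‖ =
      ‖ContinuousLinearMap.adjoint v * v‖ ^ 2 := (IsSelfAdjoint.star_mul_self v).norm_mul_self
  rw [hidem, h1] at h2
  by_contra! hv
  have h3 : 1 < ‖v‖ * ‖v‖ := by nlinarith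
  nlinarith

/-- The initial projection of the polar part fixes the absolute value. -/
theorem adjoint_polar_mul {x v : H →L[ℂ] H} (hpol : x = v * opAbs x)
    (hpi : v * ContinuousLinearMap.adjoint v * v = v) :
    ContinuousLinearMap.adjoint v * x = opAbs x := by
  ext ξ
  have hv (η : H) : v (opAbs x η) = x η := congr($hpol η).symm
  rw [mul_apply_eq_comp, ← hv ξ]
  exact adjoint_apply_apply_of_norm_eq (norm_le_one_of_mul_adjoint_mul_self hpi)
    (by rw [hv, norm_opAbs_apply])

end TraceClass

/-- Let `x ∈ L¹(B(H)) \ V` be a smooth point of `L¹(B(H))` in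
the trace norm (expressed, via the isometric identification
`(L¹(B(H)))* ≅ B(H)`, as the uniqueness of a norm-one `a ∈ B(H)` with
`Tr(ax) = ‖x‖₁`), with polar decomposition `x = v|x|` for the unique partial
isometry `v` with initial space the closure of the range of `|x|`.  Then `0` is
a best approximation to `x` out of `V` iff `v* ∈ N_V`. -/
theorem zero_bestApprox_iff_adjoint_polar_mem {H : Type*} [NormedAddCommGroup H]
    [InnerProductSpace ℂ H] [CompleteSpace H]
    (hinf : ¬FiniteDimensional ℂ H) (b : HilbertBasis ℕ ℂ H)
    (V : Submodule ℂ (H →L[ℂ] H)) [FiniteDimensional ℂ V]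
    (hV : ∀ w ∈ V, IsTraceClass b w)
    (x v : H →L[ℂ] H) (hxt : IsTraceClass b x) (hx : x ∉ V)
    (hsmooth : ∃! a : H →L[ℂ] H, ‖a‖ = 1 ∧
      traceAlong b (a * x) = ((traceNorm b x : ℝ) : ℂ))
    (hpol : x = v * opAbs x)
    (hpi : v * ContinuousLinearMap.adjoint v * v = v)
    (hinit : ∀ ξ : H, (∀ η : H, ⟪opAbs x η, ξ⟫_ℂ = 0) → v ξ = 0) :
    sInf {r : ℝ | ∃ w ∈ V, r = traceNorm b (x - w)} = traceNorm b x ↔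
      ∀ y ∈ V, traceAlong b (ContinuousLinearMap.adjoint v * y) = 0 := by
  have hx0 : x ≠ 0 := fun h => hx (h ▸ V.zero_mem)
  have hv1 : ‖ContinuousLinearMap.adjoint v‖ ≤ 1 := by
    rw [LinearIsometryEquiv.norm_map]
    exact norm_le_one_of_mul_adjoint_mul_self hpi
  have hvx : traceAlong b (ContinuousLinearMap.adjoint v * x) = (traceNorm b x : ℂ) := by
    rw [adjoint_polar_mul hpol hpi, traceAlong_opAbs]
  constructor
  · intro hdist y hy
    have hbest (w) (hw : w ∈ V) : traceNorm b x ≤ traceNorm b (x - w) := by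
      rw [← hdist]
      refine csInf_le ⟨0, ?_⟩ ⟨w, hw, rfl⟩
      rintro _ ⟨z, -, rfl⟩
      exact traceNorm_nonneg b _
    obtain ⟨f, hf, hfx, hfV⟩ := exists_functional_of_traceNorm_le hV hxt hx hbest
    obtain ⟨a, ha, haf⟩ := exists_traceAlong_mul_eq f hf
    have hax : traceAlong b (a * x) = (traceNorm b x : ℂ) := (haf x hxt).trans hfx
    have hav : ContinuousLinearMap.adjoint v = a := hsmooth.unique
      ⟨norm_eq_one_of_traceAlong_mul_eq hxt hx0 hv1 hvx, hvx⟩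
      ⟨norm_eq_one_of_traceAlong_mul_eq hxt hx0 ha hax, hax⟩
    rw [hav, haf y (hV y hy), hfV y hy]
  · intro hzero
    refine IsLeast.csInf_eq ⟨⟨0, V.zero_mem, by rw [sub_zero]⟩, ?_⟩
    rintro _ ⟨w, hw, rfl⟩
    have hadd := traceAlong_mul_add (ContinuousLinearMap.adjoint v)
      (isTraceClass_sub hxt (hV w hw)) (hV w hw)
    rw [sub_add_cancel, hvx, hzero w hw, add_zero] at hadd
    have hle := (isTraceClass_sub hxt (hV w hw)).norm_traceAlong_mul_le
      (ContinuousLinearMap.adjoint v)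
    rw [← hadd, Complex.norm_real, Real.norm_of_nonneg (traceNorm_nonneg b x)] at hle
    exact hle.trans (mul_le_of_le_one_left (traceNorm_nonneg b _) hv1)
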